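/- arXiv:1202.1675 — 4 statements merged into one kernel-verified Lean document; each statement's English description precedes it below -/
import Mathlib

section
/- Let n ≥ 1 and j ∈ {1,…,n}. There exist constants C > 0 and c > 0 such that for all x, y ∈ ℝⁿ and all s > 0, |V_{j,s}(x,y)| ≤ C e^{-c(|x-y|² + (|x|+|y|)|x-y|)} · e^{-ns - c|x-y|²/s} / (1-e^{-4s})^{(n+1)/2}. -/
open Real MeasureTheory Set

/-- The Mehler (Hermite heat) kernel on ℝⁿ. -/
noncomputable def W (n : ℕ) (s : ℝ) (x y : EuclideanSpace ℝ (Fin n)) : ℝ :=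
  (Real.exp (-2 * s) / (Real.pi * (1 - Real.exp (-4 * s)))) ^ ((n : ℝ) / 2) *
    Real.exp (-(1 / 4) * ((1 + Real.exp (-2 * s)) / (1 - Real.exp (-2 * s)) * ‖x - y‖ ^ 2 +
      (1 - Real.exp (-2 * s)) / (1 + Real.exp (-2 * s)) * ‖x + y‖ ^ 2))

/-- V_{j,s}(x,y) = ∂_{x_j} W_s(x,y). -/
noncomputable def V (n : ℕ) (j : Fin n) (s : ℝ) (x y : EuclideanSpace ℝ (Fin n)) : ℝ :=
  -(1 / 2) * ((1 + Real.exp (-2 * s)) / (1 - Real.exp (-2 * s)) * (x j - y j) +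
    (1 - Real.exp (-2 * s)) / (1 + Real.exp (-2 * s)) * (x j + y j)) * W n s x y

/-- A linear factor is absorbed by half of the Gaussian exponent `a D² + a⁻¹ S²`. -/
lemma linear_mul_exp_le {a b D S : ℝ} (ha : 1 ≤ a) (hab : a * b = 1) :
    (a * D + b * S) * exp (-(1 / 8) * (a * D ^ 2 + b * S ^ 2)) ≤ √(8 * a) := by
  apply Real.le_sqrt_of_sq_le
  have hb : 0 < b := pos_of_mul_pos_right (by rw [hab]; exact one_pos) (by linarith)
  have hba : b ≤ a := by nlinarith
  set E := a * D ^ 2 + b * S ^ 2 with hE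
  have hsq : (a * D + b * S) ^ 2 ≤ 2 * a * E := by
    have h₁ : b * b * S ^ 2 ≤ a * b * S ^ 2 := by gcongr
    nlinarith [sq_nonneg (a * D - b * S)]
  have hexp : exp (-(1 / 8) * E) ^ 2 = (exp (E / 4))⁻¹ := by
    rw [← exp_nat_mul, ← exp_neg]
    congr 1
    push_cast
    ring
  have hlin : E ≤ 4 * exp (E / 4) := by linarith [add_one_le_exp (E / 4)]
  rw [mul_pow, hexp, ← div_eq_mul_inv, div_le_iff₀ (exp_pos _)]
  calc (a * D + b * S) ^ 2 ≤ 2 * a * E := hsq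
    _ ≤ 2 * a * (4 * exp (E / 4)) := by gcongr
    _ = 8 * a * exp (E / 4) := by ring

/-- The Gaussian exponent `a ‖x - y‖² + a⁻¹ ‖x + y‖²` controls every term of the decay factor. -/
lemma decay_le_exponent {F : Type*} [NormedAddCommGroup F] [NormedSpace ℝ F] {a b s : ℝ}
    (ha : 1 ≤ a) (hab : a * b = 1) (has : 1 / s ≤ 2 * a) (x y : F) :
    ‖x - y‖ ^ 2 + (‖x‖ + ‖y‖) * ‖x - y‖ + ‖x - y‖ ^ 2 / s ≤
      5 * (a * ‖x - y‖ ^ 2 + b * ‖x + y‖ ^ 2) := by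
  have hb : 0 < b := pos_of_mul_pos_right (by rw [hab]; exact one_pos) (by linarith)
  have hx : 2 * ‖x‖ ≤ ‖x - y‖ + ‖x + y‖ := by
    have h := norm_add_le (x - y) (x + y)
    rwa [show x - y + (x + y) = (2 : ℝ) • x by module, norm_smul, Real.norm_two] at h
  have hy : 2 * ‖y‖ ≤ ‖x - y‖ + ‖x + y‖ := by
    have h := norm_sub_le (x + y) (x - y)
    rw [show x + y - (x - y) = (2 : ℝ) • y by module, norm_smul, Real.norm_two] at h
    linarith
  have hcross : 2 * (‖x - y‖ * ‖x + y‖) ≤ a * ‖x - y‖ ^ 2 + b * ‖x + y‖ ^ 2 := by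
    have h : a * ‖x - y‖ ^ 2 + b * ‖x + y‖ ^ 2 - 2 * (‖x - y‖ * ‖x + y‖) =
        b * (a * ‖x - y‖ - ‖x + y‖) ^ 2 := by
      linear_combination (2 * (‖x - y‖ * ‖x + y‖) - a * ‖x - y‖ ^ 2) * hab
    have : 0 ≤ b * (a * ‖x - y‖ - ‖x + y‖) ^ 2 := by positivity
    linarith
  have hsum : (‖x‖ + ‖y‖) * ‖x - y‖ ≤ (‖x - y‖ + ‖x + y‖) * ‖x - y‖ := by
    apply mul_le_mul_of_nonneg_right _ (norm_nonneg _)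
    linarith
  have hone : 1 * ‖x - y‖ ^ 2 ≤ a * ‖x - y‖ ^ 2 := by gcongr
  have htime : 1 / s * ‖x - y‖ ^ 2 ≤ 2 * a * ‖x - y‖ ^ 2 := by gcongr
  have hS : 0 ≤ b * ‖x + y‖ ^ 2 := by positivity
  rw [div_eq_mul_one_div (‖x - y‖ ^ 2) s]
  linarith [sq_nonneg ‖x - y‖]

/-- The normalising factor of the Mehler kernel is at most `e^{-ns} / (1 - e^{-4s})^{n/2}`. -/
lemma mehler_prefactor_le (n : ℕ) {s r : ℝ} (hr : 0 < r) :
    (exp (-2 * s) / (π * r)) ^ ((n : ℝ) / 2) ≤ exp (-(n : ℝ) * s) / r ^ ((n : ℝ) / 2) := by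
  have hexp : exp (-(n : ℝ) * s) = exp (-2 * s) ^ ((n : ℝ) / 2) := by
    rw [← exp_mul]
    congr 1
    ring
  rw [hexp, ← div_rpow (exp_pos _).le hr.le]
  have hπ : 1 * r ≤ π * r := by
    gcongr
    linarith [pi_gt_three]
  gcongr
  linarith

theorem V_bound (n : ℕ) (hn : 1 ≤ n) (j : Fin n) :
    ∃ C > (0 : ℝ), ∃ c > (0 : ℝ), ∀ (x y : EuclideanSpace ℝ (Fin n)) (s : ℝ), 0 < s →
      |V n j s x y| ≤
        C * Real.exp (-c * (‖x - y‖ ^ 2 + (‖x‖ + ‖y‖) * ‖x - y‖)) *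
          (Real.exp (-(n : ℝ) * s - c * ‖x - y‖ ^ 2 / s) /
            (1 - Real.exp (-4 * s)) ^ (((n : ℝ) + 1) / 2)) := by
  refine ⟨3, by norm_num, 1 / 40, by norm_num, fun x y s hs => ?_⟩
  have hq0 : 0 < exp (-2 * s) := exp_pos _
  have hq1 : exp (-2 * s) < 1 := exp_lt_one_iff.mpr (by linarith)
  have hqs : 1 - 2 * s ≤ exp (-2 * s) := by linarith [add_one_le_exp (-2 * s)]
  have hq4 : exp (-4 * s) = exp (-2 * s) ^ 2 := by
    rw [← exp_nat_mul]
    congr 1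
    push_cast
    ring
  have hr : 0 < 1 - exp (-4 * s) := by
    rw [hq4]
    nlinarith
  have hpre := mehler_prefactor_le n (s := s) hr
  unfold V W
  set r := 1 - exp (-4 * s) with hr_def
  set q := exp (-2 * s)
  set a := (1 + q) / (1 - q) with ha_def
  set b := (1 - q) / (1 + q) with hb_def
  have hq : 0 < 1 - q := by linarith
  have ha : 1 ≤ a := by
    rw [ha_def, le_div_iff₀ hq]
    linarith
  have hb : 0 < b := by positivity
  have hab : a * b = 1 := by
    rw [ha_def, hb_def]
    field_simp
  have has : 1 / s ≤ 2 * a := by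
    rw [ha_def, ← mul_div_assoc, div_le_div_iff₀ hs hq]
    nlinarith
  have har : √(8 * a) ≤ 6 / √r := by
    have h : 8 * a ≤ 36 / r := by
      rw [ha_def, hr_def, hq4, ← mul_div_assoc, div_le_div_iff₀ hq (by rw [← hq4]; exact hr)]
      nlinarith [mul_pos hq (by linarith : (0 : ℝ) < 2 + q)]
    calc √(8 * a) ≤ √(36 / r) := Real.sqrt_le_sqrt h
      _ = 6 / √r := by
        rw [Real.sqrt_div (by norm_num), show (36 : ℝ) = 6 ^ 2 by norm_num,
          Real.sqrt_sq (by norm_num)]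
  set E := a * ‖x - y‖ ^ 2 + b * ‖x + y‖ ^ 2 with hE
  have hlin : |a * (x j - y j) + b * (x j + y j)| ≤ a * ‖x - y‖ + b * ‖x + y‖ := by
    have hm : |x j - y j| ≤ ‖x - y‖ := by simpa using PiLp.norm_apply_le (x - y) j
    have hp : |x j + y j| ≤ ‖x + y‖ := by simpa using PiLp.norm_apply_le (x + y) j
    refine (abs_add_le _ _).trans ?_
    rw [abs_mul, abs_mul, abs_of_pos hb, abs_of_pos (by linarith : 0 < a)]
    gcongr
  have habsorb : (a * ‖x - y‖ + b * ‖x + y‖) * exp (-(1 / 8) * E) ≤ 6 / √r :=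
    (linear_mul_exp_le ha hab).trans har
  have hdecay : exp (-(1 / 8) * E) ≤
      exp (-(1 / 40) * (‖x - y‖ ^ 2 + (‖x‖ + ‖y‖) * ‖x - y‖)) *
        exp (-(1 / 40 * ‖x - y‖ ^ 2 / s)) := by
    rw [← exp_add, exp_le_exp]
    have h := decay_le_exponent ha hab has x y
    have hc : 1 / 40 * ‖x - y‖ ^ 2 / s = 1 / 40 * (‖x - y‖ ^ 2 / s) := by ring
    linarith
  have hsplit : exp (-(1 / 4) * E) = exp (-(1 / 8) * E) * exp (-(1 / 8) * E) := by
    rw [← exp_add]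
    congr 1
    ring
  have hpow : r ^ (((n : ℝ) + 1) / 2) = r ^ ((n : ℝ) / 2) * √r := by
    rw [Real.sqrt_eq_rpow, ← rpow_add hr]
    congr 1
    ring
  have hW : 0 ≤ (q / (π * r)) ^ ((n : ℝ) / 2) := by positivity
  rw [abs_mul, abs_mul, abs_mul, abs_of_nonneg hW, abs_of_pos (exp_pos (-(1 / 4) * E)), hsplit,
    hpow, sub_eq_add_neg _ (1 / 40 * ‖x - y‖ ^ 2 / s), exp_add,
    show |(-(1 / 2) : ℝ)| = 1 / 2 by rw [abs_neg, abs_of_pos (by norm_num)]]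
  calc 1 / 2 * |a * (x j - y j) + b * (x j + y j)| *
        ((q / (π * r)) ^ ((n : ℝ) / 2) * (exp (-(1 / 8) * E) * exp (-(1 / 8) * E)))
      ≤ 1 / 2 * (a * ‖x - y‖ + b * ‖x + y‖) *
        ((q / (π * r)) ^ ((n : ℝ) / 2) * (exp (-(1 / 8) * E) * exp (-(1 / 8) * E))) := by
        gcongr
    _ = 1 / 2 * ((a * ‖x - y‖ + b * ‖x + y‖) * exp (-(1 / 8) * E)) *
        (q / (π * r)) ^ ((n : ℝ) / 2) * exp (-(1 / 8) * E) := by ring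
    _ ≤ 1 / 2 * (6 / √r) * (exp (-(n : ℝ) * s) / r ^ ((n : ℝ) / 2)) *
        (exp (-(1 / 40) * (‖x - y‖ ^ 2 + (‖x‖ + ‖y‖) * ‖x - y‖)) *
          exp (-(1 / 40 * ‖x - y‖ ^ 2 / s))) := by gcongr
    _ = _ := by
      field_simp
      norm_num
end

section
/- Let n ≥ 1, α > -n and j ∈ {1,…,n}. There exists a constant C > 0 such that for all x, y ∈ ℝⁿ with x ≠ y, (∫_0^∞ Q_{j,t}^α(x,y)² dt/t)^{1/2} ≤ C / |x-y|^{n+1}. -/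
open Real MeasureTheory Set

/-- Q_{j,t}^α(x,y) = ∂_{x_j}[t ∂_t P_t^α(x,y)]. -/
noncomputable def Qj (n : ℕ) (j : Fin n) (α : ℝ) (t : ℝ) (x y : EuclideanSpace ℝ (Fin n)) : ℝ :=
  t / Real.sqrt (4 * Real.pi) *
    ∫ s in Set.Ioi (0 : ℝ), s ^ (-(3 : ℝ) / 2) * (1 - t ^ 2 / (2 * s)) *
      Real.exp (-t ^ 2 / (4 * s)) * Real.exp (-α * s) * V n j s x y

/-- The rational function of `exp (-2 * s)` in the Mehler kernel, equal to `tanh s`. -/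
noncomputable def mehlerTanh (s : ℝ) : ℝ :=
  (1 - Real.exp (-2 * s)) / (1 + Real.exp (-2 * s))

lemma mehlerTanh_pos {s : ℝ} (hs : 0 < s) : 0 < mehlerTanh s := by
  have hE : Real.exp (-2 * s) < 1 := Real.exp_lt_one_iff.2 (by linarith)
  have hE0 := Real.exp_pos (-2 * s)
  exact div_pos (by linarith) (by linarith)

lemma mehlerTanh_le_one (s : ℝ) : mehlerTanh s ≤ 1 := by
  have hE0 := Real.exp_pos (-2 * s)
  exact (div_le_one (by linarith)).2 (by linarith)

lemma mehlerTanh_le_two_mul {s : ℝ} (hs : 0 < s) : mehlerTanh s ≤ 2 * s := by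
  have hE0 := Real.exp_pos (-2 * s)
  have h := Real.add_one_le_exp (-2 * s)
  rw [mehlerTanh, div_le_iff₀ (by linarith)]
  nlinarith

lemma le_one_add_mul_mehlerTanh (s : ℝ) : s ≤ (1 + s) * mehlerTanh s := by
  have hE0 := Real.exp_pos (-2 * s)
  have h := Real.add_one_le_exp (2 * s)
  have hmul : Real.exp (-2 * s) * Real.exp (2 * s) = 1 := by
    rw [← Real.exp_add]; simp
  rw [mehlerTanh, mul_div_assoc', le_div_iff₀ (by linarith)]
  nlinarith

lemma mul_exp_neg_sq_div_eight_le (z : ℝ) : z * Real.exp (-(z ^ 2 / 8)) ≤ 2 := by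
  have h := Real.add_one_le_exp (z ^ 2 / 8)
  rw [Real.exp_neg, ← div_eq_mul_inv, div_le_iff₀ (Real.exp_pos _)]
  nlinarith [sq_nonneg (z - 2)]

lemma abs_one_sub_mul_exp_neg_le {u : ℝ} (hu : 0 ≤ u) :
    |1 - 2 * u| * Real.exp (-u) ≤ 4 * Real.exp (-(u / 4)) := by
  have h := Real.add_one_le_exp (3 * u / 4)
  have habs : |1 - 2 * u| ≤ 4 * Real.exp (3 * u / 4) := by
    rw [abs_le]; constructor <;> linarith
  calc |1 - 2 * u| * Real.exp (-u) ≤ 4 * Real.exp (3 * u / 4) * Real.exp (-u) := by gcongr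
    _ = 4 * Real.exp (-(u / 4)) := by
      rw [mul_assoc, ← Real.exp_add]; ring_nf

lemma exists_one_add_pow_mul_exp_neg_le (m : ℕ) {δ : ℝ} (hδ : 0 < δ) :
    ∃ C > 0, ∀ s : ℝ, 0 ≤ s → (1 + s) ^ m * Real.exp (-δ * s) ≤ C := by
  refine ⟨Real.exp δ * m.factorial / δ ^ m, by positivity, fun s hs => ?_⟩
  have h := Real.pow_div_factorial_le_exp (δ * (1 + s)) (by positivity) m
  rw [div_le_iff₀ (by positivity), mul_pow, mul_add, mul_one, Real.exp_add] at h
  rw [le_div_iff₀ (by positivity), neg_mul, Real.exp_neg, ← div_eq_mul_inv, div_mul_eq_mul_div,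
    div_le_iff₀ (Real.exp_pos _)]
  linarith

/-- Gaussian bound for the drift factor of the gradient of the Mehler kernel. -/
lemma drift_mul_exp_le {τ a b : ℝ} (hτ : 0 < τ) (hτ1 : τ ≤ 1) (hb : 0 ≤ b) :
    (a / τ + τ * b) * Real.exp (-(1 / 4) * (a ^ 2 / τ + τ * b ^ 2)) ≤
      4 * τ ^ (-(1 : ℝ) / 2) * Real.exp (-(a ^ 2 / (8 * τ))) := by
  set q := Real.sqrt τ
  have hq0 : 0 < q := Real.sqrt_pos.2 hτ
  have hq2 : q ^ 2 = τ := Real.sq_sqrt hτ.le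
  have hq1 : q ≤ 1 := by nlinarith
  have hpow : τ ^ (-(1 : ℝ) / 2) = 1 / q := by
    rw [neg_div, Real.rpow_neg hτ.le, ← Real.sqrt_eq_rpow, one_div]
  have hsplit : Real.exp (-(1 / 4) * (a ^ 2 / τ + τ * b ^ 2)) =
      Real.exp (-((a / q) ^ 2 / 8)) * Real.exp (-((q * b) ^ 2 / 8)) *
        Real.exp (-((q * b) ^ 2 / 8)) * Real.exp (-(a ^ 2 / (8 * τ))) := by
    rw [← Real.exp_add, ← Real.exp_add, ← Real.exp_add]
    congr 1
    rw [← hq2]; field_simp; ring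
  have h1 := mul_exp_neg_sq_div_eight_le (a / q)
  have h2 := mul_exp_neg_sq_div_eight_le (q * b)
  have e1 : Real.exp (-((a / q) ^ 2 / 8)) ≤ 1 := Real.exp_le_one_iff.2 (by simp; positivity)
  have e2 : Real.exp (-((q * b) ^ 2 / 8)) ≤ 1 := Real.exp_le_one_iff.2 (by simp; positivity)
  rw [hsplit, hpow, ← mul_assoc]
  refine mul_le_mul_of_nonneg_right ?_ (Real.exp_pos _).le
  set A := Real.exp (-((a / q) ^ 2 / 8))
  set B := Real.exp (-((q * b) ^ 2 / 8))
  have hA : 0 < A := Real.exp_pos _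
  have hB : 0 < B := Real.exp_pos _
  have hBB : B * B ≤ 1 := by nlinarith
  have hAB : A * B ≤ 1 := by nlinarith
  have hdec : (a / τ + τ * b) * (A * B * B) =
      (1 / q) * ((a / q * A) * (B * B) + q ^ 2 * (q * b * B) * (A * B)) := by
    rw [← hq2]; field_simp
  rw [hdec, mul_comm (4 : ℝ)]
  refine mul_le_mul_of_nonneg_left ?_ (by positivity)
  have k1 : (a / q * A) * (B * B) ≤ 2 * 1 := by gcongr
  have k2 : q ^ 2 * (q * b * B) * (A * B) ≤ 1 * 2 * 1 := by
    gcongr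
    exact pow_le_one₀ hq0.le hq1
  linarith

lemma mehler_prefactor_le_s4 (n : ℕ) {s : ℝ} (hs : 0 < s) :
    (Real.exp (-2 * s) / (Real.pi * (1 - Real.exp (-4 * s)))) ^ ((n : ℝ) / 2) ≤
      Real.exp (-n * s) * mehlerTanh s ^ (-(n : ℝ) / 2) := by
  have hE : Real.exp (-2 * s) < 1 := Real.exp_lt_one_iff.2 (by linarith)
  have hE0 := Real.exp_pos (-2 * s)
  have hsq : Real.exp (-4 * s) = Real.exp (-2 * s) ^ 2 := by
    rw [← Real.exp_nat_mul]; congr 1; push_cast; ring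
  have hτ := mehlerTanh_pos hs
  have hden : mehlerTanh s ≤ Real.pi * (1 - Real.exp (-4 * s)) := by
    rw [hsq, mehlerTanh, div_le_iff₀ (by linarith)]
    have h1 : (1 : ℝ) ≤ Real.pi * (1 + Real.exp (-2 * s)) ^ 2 := by
      nlinarith [Real.pi_gt_three]
    nlinarith
  calc (Real.exp (-2 * s) / (Real.pi * (1 - Real.exp (-4 * s)))) ^ ((n : ℝ) / 2)
      ≤ (Real.exp (-2 * s) / mehlerTanh s) ^ ((n : ℝ) / 2) := by
        have := hτ.trans_le hden
        gcongr
    _ = Real.exp (-n * s) * mehlerTanh s ^ (-(n : ℝ) / 2) := by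
        rw [Real.div_rpow hE0.le hτ.le, ← Real.exp_mul, neg_div, Real.rpow_neg hτ.le,
          div_eq_mul_inv]
        ring_nf

/-- Gaussian bound for the gradient of the Mehler kernel. -/
lemma abs_V_le (n : ℕ) (j : Fin n) {s : ℝ} (hs : 0 < s) (x y : EuclideanSpace ℝ (Fin n)) :
    |V n j s x y| ≤ 2 * Real.exp (-n * s) * mehlerTanh s ^ (-((n : ℝ) + 1) / 2) *
      Real.exp (-(‖x - y‖ ^ 2 / (8 * mehlerTanh s))) := by
  have hτ := mehlerTanh_pos hs
  have hinv : (1 + Real.exp (-2 * s)) / (1 - Real.exp (-2 * s)) = (mehlerTanh s)⁻¹ := by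
    rw [mehlerTanh, inv_div]
  have hx : |x j - y j| ≤ ‖x - y‖ := PiLp.norm_apply_le (x - y) j
  have hy : |x j + y j| ≤ ‖x + y‖ := PiLp.norm_apply_le (x + y) j
  have hpre := mehler_prefactor_le_s4 n hs
  have hdrift := drift_mul_exp_le hτ (mehlerTanh_le_one s)
    (a := ‖x - y‖) (norm_nonneg (x + y))
  unfold V W
  rw [hinv, ← mehlerTanh]
  set τ := mehlerTanh s
  have hpre0 : 0 ≤ (Real.exp (-2 * s) / (Real.pi * (1 - Real.exp (-4 * s)))) ^ ((n : ℝ) / 2) := by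
    have : Real.exp (-4 * s) < 1 := Real.exp_lt_one_iff.2 (by linarith)
    exact Real.rpow_nonneg (div_nonneg (Real.exp_pos _).le
      (mul_nonneg Real.pi_pos.le (by linarith))) _
  set P := (Real.exp (-2 * s) / (Real.pi * (1 - Real.exp (-4 * s)))) ^ ((n : ℝ) / 2)
  have hfac : |τ⁻¹ * (x j - y j) + τ * (x j + y j)| ≤ ‖x - y‖ / τ + τ * ‖x + y‖ := by
    refine (abs_add_le _ _).trans ?_
    rw [abs_mul, abs_mul, abs_of_pos hτ, abs_of_pos (inv_pos.2 hτ), div_eq_inv_mul]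
    gcongr
  have hexp : -(1 / 4) * (τ⁻¹ * ‖x - y‖ ^ 2 + τ * ‖x + y‖ ^ 2) =
      -(1 / 4) * (‖x - y‖ ^ 2 / τ + τ * ‖x + y‖ ^ 2) := by
    rw [div_eq_inv_mul (‖x - y‖ ^ 2)]
  rw [hexp, abs_mul, abs_mul, abs_mul, abs_of_nonneg hpre0, abs_of_pos (Real.exp_pos _)]
  have hhalf : |-(1 / 2 : ℝ)| = 1 / 2 := by norm_num
  rw [hhalf]
  set G := Real.exp (-(1 / 4) * (‖x - y‖ ^ 2 / τ + τ * ‖x + y‖ ^ 2))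
  have hpow : τ ^ (-((n : ℝ) + 1) / 2) = τ ^ (-(n : ℝ) / 2) * τ ^ (-(1 : ℝ) / 2) := by
    rw [← Real.rpow_add hτ]; congr 1; ring
  calc 1 / 2 * |τ⁻¹ * (x j - y j) + τ * (x j + y j)| * (P * G)
      ≤ 1 / 2 * (‖x - y‖ / τ + τ * ‖x + y‖) * (P * G) := by gcongr
    _ = 1 / 2 * P * ((‖x - y‖ / τ + τ * ‖x + y‖) * G) := by ring
    _ ≤ 1 / 2 * (Real.exp (-n * s) * τ ^ (-(n : ℝ) / 2)) *
          (4 * τ ^ (-(1 : ℝ) / 2) * Real.exp (-(‖x - y‖ ^ 2 / (8 * τ)))) := by gcongr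
    _ = _ := by rw [hpow]; ring

lemma exists_exp_mul_abs_V_le (n : ℕ) {α : ℝ} (hα : -(n : ℝ) < α) (j : Fin n) :
    ∃ C > 0, ∀ (s : ℝ) (x y : EuclideanSpace ℝ (Fin n)), 0 < s →
      Real.exp (-α * s) * |V n j s x y| ≤
        C * (s ^ (-((n : ℝ) + 1) / 2) * Real.exp (-(‖x - y‖ ^ 2 / (16 * s)))) := by
  obtain ⟨C, hC, hb⟩ := exists_one_add_pow_mul_exp_neg_le (n + 1) (δ := α + n) (by linarith)
  refine ⟨2 * C, by positivity, fun s x y hs => ?_⟩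
  have hτ := mehlerTanh_pos hs
  have hV := abs_V_le n j hs x y
  have hτs := mehlerTanh_le_two_mul hs
  have hsτ := le_one_add_mul_mehlerTanh s
  set τ := mehlerTanh s
  have hgauss : Real.exp (-(‖x - y‖ ^ 2 / (8 * τ))) ≤ Real.exp (-(‖x - y‖ ^ 2 / (16 * s))) := by
    refine Real.exp_le_exp.2 (neg_le_neg ?_)
    exact div_le_div_of_nonneg_left (sq_nonneg _) (by positivity) (by linarith)
  have hpow : τ ^ (-((n : ℝ) + 1) / 2) ≤ (1 + s) ^ (n + 1) * s ^ (-((n : ℝ) + 1) / 2) := by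
    have hle : s / (1 + s) ≤ τ := by
      rw [div_le_iff₀ (by linarith)]; linarith
    calc τ ^ (-((n : ℝ) + 1) / 2) ≤ (s / (1 + s)) ^ (-((n : ℝ) + 1) / 2) :=
          Real.rpow_le_rpow_of_nonpos (by positivity) hle
            (by have := n.cast_nonneg (α := ℝ); linarith)
      _ = (1 + s) ^ (((n : ℝ) + 1) / 2) * s ^ (-((n : ℝ) + 1) / 2) := by
          rw [Real.div_rpow hs.le (by linarith), neg_div, Real.rpow_neg (by linarith : 0 ≤ 1 + s),
            div_inv_eq_mul, mul_comm]
      _ ≤ (1 + s) ^ (n + 1) * s ^ (-((n : ℝ) + 1) / 2) := by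
          gcongr
          rw [← Real.rpow_natCast]
          refine Real.rpow_le_rpow_of_exponent_le (by linarith) ?_
          push_cast
          have := n.cast_nonneg (α := ℝ); linarith
  have hexp : Real.exp (-α * s) * Real.exp (-n * s) = Real.exp (-(α + n) * s) := by
    rw [← Real.exp_add]; congr 1; ring
  calc Real.exp (-α * s) * |V n j s x y|
      ≤ Real.exp (-α * s) * (2 * Real.exp (-n * s) * ((1 + s) ^ (n + 1) *
          s ^ (-((n : ℝ) + 1) / 2)) * Real.exp (-(‖x - y‖ ^ 2 / (16 * s)))) := by
        refine mul_le_mul_of_nonneg_left (hV.trans ?_) (Real.exp_pos _).le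
        gcongr
    _ = 2 * ((1 + s) ^ (n + 1) * (Real.exp (-α * s) * Real.exp (-n * s))) *
          (s ^ (-((n : ℝ) + 1) / 2) * Real.exp (-(‖x - y‖ ^ 2 / (16 * s)))) := by ring
    _ ≤ 2 * C * (s ^ (-((n : ℝ) + 1) / 2) * Real.exp (-(‖x - y‖ ^ 2 / (16 * s)))) := by
        rw [hexp]
        gcongr
        exact hb s hs.le

/-- The Gamma integral after inversion of the variable. -/
lemma integrableOn_and_integral_rpow_mul_exp_neg_div {p b : ℝ} (hp : 0 < p) (hb : 0 < b) :
    IntegrableOn (fun s : ℝ => s ^ (-p - 1) * Real.exp (-(b / s))) (Ioi 0) ∧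
      ∫ s in Ioi (0 : ℝ), s ^ (-p - 1) * Real.exp (-(b / s)) = (1 / b) ^ p * Real.Gamma p := by
  let f : ℝ → ℝ := fun u => u ^ (p - 1) * Real.exp (-(b * u))
  have hf : IntegrableOn f (Ioi 0) := by
    simpa [f] using integrableOn_rpow_mul_exp_neg_mul_rpow (p := 1) (s := p - 1)
      (by linarith) one_pos hb
  have hcongr : ∀ s ∈ Ioi (0 : ℝ),
      (|(-1 : ℝ)| * s ^ ((-1 : ℝ) - 1)) • f (s ^ (-1 : ℝ)) =
        s ^ (-p - 1) * Real.exp (-(b / s)) := by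
    intro s hs
    have hs : 0 < s := hs
    simp only [f, smul_eq_mul, abs_neg, abs_one, one_mul]
    rw [← Real.rpow_mul hs.le, ← mul_assoc, ← Real.rpow_add hs, Real.rpow_neg_one,
      div_eq_mul_inv]
    ring_nf
  constructor
  · exact ((integrableOn_Ioi_comp_rpow_iff f (by norm_num : (-1 : ℝ) ≠ 0)).2 hf).congr_fun hcongr
      measurableSet_Ioi
  · rw [← setIntegral_congr_fun measurableSet_Ioi hcongr,
      integral_comp_rpow_Ioi f (by norm_num : (-1 : ℝ) ≠ 0)]
    exact Real.integral_rpow_mul_exp_neg_mul_Ioi hp hb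

lemma integrableOn_and_integral_div_sq_add_sq_pow {r : ℝ} (hr : 0 < r) (m : ℕ) :
    IntegrableOn (fun t : ℝ => t / (t ^ 2 + r ^ 2) ^ (m + 2)) (Ioi 0) ∧
      ∫ t in Ioi (0 : ℝ), t / (t ^ 2 + r ^ 2) ^ (m + 2) =
        1 / (2 * (m + 1) * (r ^ 2) ^ (m + 1)) := by
  let F : ℝ → ℝ := fun t => -(1 / (2 * (m + 1))) * ((t ^ 2 + r ^ 2) ^ (m + 1))⁻¹
  have hderiv : ∀ t ∈ Ici (0 : ℝ), HasDerivAt F (t / (t ^ 2 + r ^ 2) ^ (m + 2)) t := by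
    intro t _
    have hpos : 0 < t ^ 2 + r ^ 2 := by positivity
    have h := (((((hasDerivAt_id t).pow 2).add_const (r ^ 2)).pow (m + 1)).inv
      (pow_ne_zero (m + 1) hpos.ne')).const_mul (-(1 / (2 * ((m : ℝ) + 1))))
    refine h.congr_deriv ?_
    simp only [id, Pi.pow_apply]
    push_cast
    have : (m : ℝ) + 1 ≠ 0 := by positivity
    field_simp
    ring
  have hnonneg : ∀ t ∈ Ioi (0 : ℝ), 0 ≤ t / (t ^ 2 + r ^ 2) ^ (m + 2) := by
    intro t ht
    have ht : 0 < t := ht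
    positivity
  have hlim : Filter.Tendsto F Filter.atTop (nhds 0) := by
    have h1 : Filter.Tendsto (fun t : ℝ => (t ^ 2 + r ^ 2) ^ (m + 1)) Filter.atTop Filter.atTop :=
      (Filter.tendsto_pow_atTop m.succ_ne_zero).comp
        (Filter.tendsto_atTop_add_const_right _ _ (Filter.tendsto_pow_atTop two_ne_zero))
    simpa [F] using h1.inv_tendsto_atTop.const_mul (-(1 / (2 * ((m : ℝ) + 1))))
  refine ⟨integrableOn_Ioi_deriv_of_nonneg' hderiv hnonneg hlim, ?_⟩
  rw [integral_Ioi_of_hasDerivAt_of_nonneg' hderiv hnonneg hlim]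
  simp only [F]
  field_simp
  simp

lemma exists_abs_Qj_le (n : ℕ) {α : ℝ} (hα : -(n : ℝ) < α) (j : Fin n) :
    ∃ C > 0, ∀ (t : ℝ) (x y : EuclideanSpace ℝ (Fin n)), 0 < t →
      |Qj n j α t x y| ≤ C * t * (1 / (t ^ 2 + ‖x - y‖ ^ 2)) ^ (((n : ℝ) + 2) / 2) := by
  obtain ⟨C, hC, hV⟩ := exists_exp_mul_abs_V_le n hα j
  have hp : 0 < ((n : ℝ) + 2) / 2 := by positivity
  refine ⟨4 * C * ((16 : ℝ) ^ (((n : ℝ) + 2) / 2) * Real.Gamma (((n : ℝ) + 2) / 2)),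
    by have := Real.Gamma_pos_of_pos hp; positivity, fun t x y ht => ?_⟩
  have hR : 0 < t ^ 2 + ‖x - y‖ ^ 2 := by positivity
  obtain ⟨hint, hval⟩ := integrableOn_and_integral_rpow_mul_exp_neg_div hp
    (b := (t ^ 2 + ‖x - y‖ ^ 2) / 16) (by positivity)
  set p := ((n : ℝ) + 2) / 2 with hpdef
  have hbound : ∀ s ∈ Ioi (0 : ℝ),
      ‖s ^ (-(3 : ℝ) / 2) * (1 - t ^ 2 / (2 * s)) * Real.exp (-t ^ 2 / (4 * s)) *
        Real.exp (-α * s) * V n j s x y‖ ≤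
      4 * C * (s ^ (-p - 1) * Real.exp (-((t ^ 2 + ‖x - y‖ ^ 2) / 16 / s))) := by
    intro s hs
    have hs : 0 < s := hs
    have h1 := abs_one_sub_mul_exp_neg_le (u := t ^ 2 / (4 * s)) (by positivity)
    have e1 : 1 - 2 * (t ^ 2 / (4 * s)) = 1 - t ^ 2 / (2 * s) := by field_simp; ring
    have e2 : -t ^ 2 / (4 * s) = -(t ^ 2 / (4 * s)) := neg_div _ _
    have e3 : Real.exp (-(t ^ 2 / (4 * s) / 4)) * Real.exp (-(‖x - y‖ ^ 2 / (16 * s))) =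
        Real.exp (-((t ^ 2 + ‖x - y‖ ^ 2) / 16 / s)) := by
      rw [← Real.exp_add]; congr 1; field_simp; ring
    have e4 : s ^ (-(3 : ℝ) / 2) * s ^ (-((n : ℝ) + 1) / 2) = s ^ (-p - 1) := by
      rw [← Real.rpow_add hs]; congr 1; rw [hpdef]; ring
    rw [e1] at h1
    rw [e2, Real.norm_eq_abs, abs_mul, abs_mul, abs_mul, abs_mul, Real.abs_exp, Real.abs_exp,
      abs_of_pos (Real.rpow_pos_of_pos hs _)]
    calc s ^ (-(3 : ℝ) / 2) * |1 - t ^ 2 / (2 * s)| * Real.exp (-(t ^ 2 / (4 * s))) *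
          Real.exp (-α * s) * |V n j s x y|
        = s ^ (-(3 : ℝ) / 2) * (|1 - t ^ 2 / (2 * s)| * Real.exp (-(t ^ 2 / (4 * s)))) *
          (Real.exp (-α * s) * |V n j s x y|) := by ring
      _ ≤ s ^ (-(3 : ℝ) / 2) * (4 * Real.exp (-(t ^ 2 / (4 * s) / 4))) *
          (C * (s ^ (-((n : ℝ) + 1) / 2) * Real.exp (-(‖x - y‖ ^ 2 / (16 * s))))) := by
        exact mul_le_mul (mul_le_mul_of_nonneg_left h1 (by positivity)) (hV s x y hs)
          (by positivity) (by positivity)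
      _ = 4 * C * ((s ^ (-(3 : ℝ) / 2) * s ^ (-((n : ℝ) + 1) / 2)) *
          (Real.exp (-(t ^ 2 / (4 * s) / 4)) * Real.exp (-(‖x - y‖ ^ 2 / (16 * s))))) := by ring
      _ = _ := by rw [e3, e4]
  have hI := norm_integral_le_of_norm_le (hint.const_mul (4 * C))
    (ae_restrict_of_forall_mem measurableSet_Ioi hbound)
  rw [integral_const_mul, hval, Real.norm_eq_abs] at hI
  have hsqrt : t / Real.sqrt (4 * Real.pi) ≤ t := by
    refine div_le_self ht.le (Real.one_le_sqrt.2 ?_)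
    linarith [Real.pi_gt_three]
  have hscale : (1 / ((t ^ 2 + ‖x - y‖ ^ 2) / 16)) ^ p =
      (16 : ℝ) ^ p * (1 / (t ^ 2 + ‖x - y‖ ^ 2)) ^ p := by
    rw [← Real.mul_rpow (by norm_num) (by positivity)]
    congr 1; field_simp
  rw [Qj, abs_mul, abs_of_nonneg (by positivity : 0 ≤ t / Real.sqrt (4 * Real.pi))]
  refine (mul_le_mul hsqrt hI (abs_nonneg _) ht.le).trans_eq ?_
  rw [hscale]
  ring

theorem Qj_H_norm_bound (n : ℕ) (hn : 1 ≤ n) (α : ℝ) (hα : -(n : ℝ) < α) (j : Fin n) :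
    ∃ C > (0 : ℝ), ∀ x y : EuclideanSpace ℝ (Fin n), x ≠ y →
      Real.sqrt (∫ t in Set.Ioi (0 : ℝ), Qj n j α t x y ^ 2 / t) ≤ C / ‖x - y‖ ^ (n + 1) := by
  obtain ⟨C, hC, hQ⟩ := exists_abs_Qj_le n hα j
  refine ⟨C, hC, fun x y hxy => ?_⟩
  have hr : 0 < ‖x - y‖ := norm_pos_iff.2 (sub_ne_zero.2 hxy)
  obtain ⟨hint, hval⟩ := integrableOn_and_integral_div_sq_add_sq_pow hr n
  set r := ‖x - y‖
  have hbound : ∀ t ∈ Ioi (0 : ℝ),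
      Qj n j α t x y ^ 2 / t ≤ C ^ 2 * (t / (t ^ 2 + r ^ 2) ^ (n + 2)) := by
    intro t ht
    have ht : 0 < t := ht
    have hR : 0 < t ^ 2 + r ^ 2 := by positivity
    have hpow : ((1 / (t ^ 2 + r ^ 2)) ^ (((n : ℝ) + 2) / 2)) ^ 2 =
        1 / (t ^ 2 + r ^ 2) ^ (n + 2) := by
      rw [← one_div_pow, ← Real.rpow_mul_natCast (by positivity), ← Real.rpow_natCast _ (n + 2)]
      congr 1; push_cast; ring
    have hsq : Qj n j α t x y ^ 2 ≤ C ^ 2 * t ^ 2 * (1 / (t ^ 2 + r ^ 2) ^ (n + 2)) := by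
      rw [← hpow, ← mul_pow, ← mul_pow, ← sq_abs]
      exact pow_le_pow_left₀ (abs_nonneg _) (hQ t x y ht) 2
    rw [div_le_iff₀ ht]
    exact hsq.trans_eq (by ring)
  have hle : ∫ t in Ioi (0 : ℝ), Qj n j α t x y ^ 2 / t ≤
      ∫ t in Ioi (0 : ℝ), C ^ 2 * (t / (t ^ 2 + r ^ 2) ^ (n + 2)) :=
    integral_mono_of_nonneg
      (ae_restrict_of_forall_mem measurableSet_Ioi fun t ht =>
        div_nonneg (sq_nonneg _) (le_of_lt ht))
      (hint.const_mul _) (ae_restrict_of_forall_mem measurableSet_Ioi hbound)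
  rw [integral_const_mul, hval] at hle
  refine Real.sqrt_le_iff.2 ⟨by positivity, hle.trans ?_⟩
  rw [div_pow, div_eq_mul_inv (C ^ 2), ← one_div]
  gcongr
  rw [← pow_mul, ← pow_mul, mul_comm 2 (n + 1)]
  have hn0 : (0 : ℝ) ≤ n := n.cast_nonneg
  exact le_mul_of_one_le_left (by positivity) (by linarith)
end

section
/- Let n ≥ 1. There exist constants C > 0 and c > 0 such that for all x, y ∈ ℝⁿ and all t > 0, P_t^L(x,y) ≤ C e^{-c(|x-y|² + |x| |x-y|)} · t/(t+|x-y|)^{n+1}. -/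
open Real MeasureTheory Set

/-- The Hermite-Poisson kernel. -/
noncomputable def P (n : ℕ) (t : ℝ) (x y : EuclideanSpace ℝ (Fin n)) : ℝ :=
  t / Real.sqrt (4 * Real.pi) *
    ∫ s in Set.Ioi (0 : ℝ), s ^ (-(3 : ℝ) / 2) * Real.exp (-t ^ 2 / (4 * s)) * W n s x y

/-- `∫₀^∞ s^{-(a+1)} e^{-b/s} ds = b^{-a} Γ(a)`, by the substitution `s ↦ s⁻¹`. -/
lemma integral_rpow_mul_exp_neg_div_Ioi {a b : ℝ} (ha : 0 < a) (hb : 0 < b) :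
    ∫ s in Ioi (0 : ℝ), s ^ (-(a + 1)) * exp (-b / s) = (1 / b) ^ a * Gamma a := by
  rw [← Real.integral_rpow_mul_exp_neg_mul_Ioi ha hb,
    ← integral_comp_rpow_Ioi (fun u : ℝ => u ^ (a - 1) * exp (-(b * u)))
      (by norm_num : (-1 : ℝ) ≠ 0)]
  refine setIntegral_congr_fun measurableSet_Ioi fun s (hs : 0 < s) => ?_
  have hpow : s ^ (-(a + 1)) = s ^ ((-1 : ℝ) - 1) * (s ^ (-1 : ℝ)) ^ (a - 1) := by
    rw [← rpow_mul hs.le, ← rpow_add hs]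
    congr 1
    ring
  simp only [hpow, rpow_neg_one, smul_eq_mul, abs_neg, abs_one, one_mul, div_eq_mul_inv, neg_mul,
    mul_assoc]

lemma integrableOn_rpow_mul_exp_neg_div_Ioi {a b : ℝ} (ha : 0 < a) (hb : 0 < b) :
    IntegrableOn (fun s : ℝ => s ^ (-(a + 1)) * exp (-b / s)) (Ioi 0) := by
  refine Integrable.of_integral_ne_zero ?_
  rw [integral_rpow_mul_exp_neg_div_Ioi ha hb]
  have := Gamma_pos_of_pos ha
  positivity

/-- The base of the on-diagonal factor of the Mehler kernel is at most `s⁻¹`. -/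
lemma exp_div_pi_mul_le_inv {s : ℝ} (hs : 0 < s) :
    exp (-2 * s) / (π * (1 - exp (-4 * s))) ≤ s⁻¹ := by
  have h1 : exp (-4 * s) = exp (-2 * s) * exp (-2 * s) := by
    rw [← exp_add]
    ring_nf
  have h2 : exp (-2 * s) * exp (2 * s) = 1 := by
    rw [← exp_add]
    simp
  have h3 : 2 * s + 1 ≤ exp (2 * s) := add_one_le_exp _
  have h4 : exp (-2 * s) < 1 := exp_lt_one_iff.2 (by linarith)
  have h5 : 0 < exp (-2 * s) := exp_pos _
  have h6 : exp (-2 * s) * (2 * s) ≤ 1 - exp (-4 * s) := by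
    rw [h1, ← h2, ← mul_sub]
    exact mul_le_mul_of_nonneg_left (by linarith) h5.le
  have h7 : 0 < 1 - exp (-4 * s) := lt_of_lt_of_le (by positivity) h6
  rw [div_le_iff₀ (mul_pos pi_pos h7), inv_mul_eq_div, le_div_iff₀ hs]
  nlinarith [pi_gt_three, mul_pos h5 hs]

/-- The exponent of the Mehler kernel, with `r = |x-y|`, `p = |x+y|` and `q = |x|`, dominates both
`r²/s` and `r² + q r`. -/
lemma le_mehler_exponent {s r p q : ℝ} (hs : 0 < s) (hr : 0 ≤ r) (hq : 2 * q ≤ p + r) :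
    1 / 16 * (r ^ 2 + q * r) + r ^ 2 / (16 * s) ≤
      1 / 4 * ((1 + exp (-2 * s)) / (1 - exp (-2 * s)) * r ^ 2 +
        (1 - exp (-2 * s)) / (1 + exp (-2 * s)) * p ^ 2) := by
  have hlt : exp (-2 * s) < 1 := exp_lt_one_iff.2 (by linarith)
  have hpos : 0 < exp (-2 * s) := exp_pos _
  have hsub : 0 < 1 - exp (-2 * s) := by linarith
  have hlin : -2 * s + 1 ≤ exp (-2 * s) := add_one_le_exp _
  set K := (1 + exp (-2 * s)) / (1 - exp (-2 * s)) with hK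
  set T := (1 - exp (-2 * s)) / (1 + exp (-2 * s)) with hT
  have hT0 : 0 ≤ T := by positivity
  have hKT : T * K = 1 := by
    rw [hK, hT, div_mul_div_cancel₀ (by positivity), div_self hsub.ne']
  have hK1 : 1 ≤ K := by
    rw [hK, le_div_iff₀ hsub]
    linarith
  have hKs : 1 / (2 * s) ≤ K := by
    rw [hK, div_le_div_iff₀ (by positivity) hsub]
    nlinarith
  have hamgm : 2 * (r * p) ≤ K * r ^ 2 + T * p ^ 2 := by
    have hexp : T * (K * r - p) ^ 2 = K * r ^ 2 + T * p ^ 2 - 2 * (r * p) := by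
      linear_combination (K * r ^ 2 - 2 * r * p) * hKT
    have := mul_nonneg hT0 (sq_nonneg (K * r - p))
    linarith
  have hTp : 0 ≤ T * p ^ 2 := by positivity
  have hr2 : r ^ 2 ≤ K * r ^ 2 := le_mul_of_one_le_left (sq_nonneg r) hK1
  have hrs : r ^ 2 / (16 * s) ≤ 1 / 8 * (K * r ^ 2) := by
    have := mul_le_mul_of_nonneg_right hKs (sq_nonneg r)
    calc r ^ 2 / (16 * s) = 1 / 8 * (1 / (2 * s) * r ^ 2) := by
          ring
      _ ≤ _ := by linarith
  have hqr : 2 * q * r ≤ (p + r) * r := mul_le_mul_of_nonneg_right hq hr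
  nlinarith

lemma two_mul_norm_le_norm_add_add_norm_sub {E : Type*} [NormedAddCommGroup E] [NormedSpace ℝ E]
    (x y : E) : 2 * ‖x‖ ≤ ‖x + y‖ + ‖x - y‖ := by
  calc 2 * ‖x‖ = ‖(x + y) + (x - y)‖ := by
        rw [add_add_sub_cancel, ← two_smul ℝ x, norm_smul]
        simp
    _ ≤ _ := norm_add_le _ _

lemma W_nonneg (n : ℕ) {s : ℝ} (hs : 0 < s) (x y : EuclideanSpace ℝ (Fin n)) : 0 ≤ W n s x y := by
  have : 0 < 1 - exp (-4 * s) := sub_pos.2 (exp_lt_one_iff.2 (by linarith))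
  unfold W
  positivity

lemma W_le (n : ℕ) {s : ℝ} (hs : 0 < s) (x y : EuclideanSpace ℝ (Fin n)) :
    W n s x y ≤ s ^ (-((n : ℝ) / 2)) *
      (exp (-(1 / 16) * (‖x - y‖ ^ 2 + ‖x‖ * ‖x - y‖)) * exp (-(‖x - y‖ ^ 2 / (16 * s)))) := by
  have hden : 0 < 1 - exp (-4 * s) := sub_pos.2 (exp_lt_one_iff.2 (by linarith))
  rw [W, rpow_neg hs.le, ← inv_rpow hs.le, ← exp_add]
  gcongr ?_ * exp ?_
  · exact rpow_le_rpow (by positivity) (exp_div_pi_mul_le_inv hs) (by positivity)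
  · have := le_mehler_exponent hs (norm_nonneg (x - y)) (two_mul_norm_le_norm_add_add_norm_sub x y)
    linarith

/-- The integrand of the subordination formula is bounded by that of an explicit Gamma integral. -/
lemma poisson_integrand_le (n : ℕ) {s : ℝ} (hs : 0 < s) (x y : EuclideanSpace ℝ (Fin n)) (t : ℝ) :
    s ^ (-(3 : ℝ) / 2) * exp (-t ^ 2 / (4 * s)) * W n s x y ≤
      exp (-(1 / 16) * (‖x - y‖ ^ 2 + ‖x‖ * ‖x - y‖)) *
        (s ^ (-(((n : ℝ) + 1) / 2 + 1)) * exp (-((t + ‖x - y‖) / 6) ^ 2 / s)) := by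
  set r := ‖x - y‖
  set E := exp (-(1 / 16) * (r ^ 2 + ‖x‖ * r))
  have hpow : s ^ (-(((n : ℝ) + 1) / 2 + 1)) = s ^ (-(3 : ℝ) / 2) * s ^ (-((n : ℝ) / 2)) := by
    rw [← rpow_add hs]
    congr 1
    ring
  have hexp : exp (-t ^ 2 / (4 * s)) * exp (-(r ^ 2 / (16 * s))) ≤
      exp (-((t + r) / 6) ^ 2 / s) := by
    rw [← exp_add, exp_le_exp]
    have : -t ^ 2 / (4 * s) + -(r ^ 2 / (16 * s)) = (-t ^ 2 / 4 - r ^ 2 / 16) / s := by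
      ring
    rw [this]
    gcongr
    nlinarith [sq_nonneg (t - r), sq_nonneg t, sq_nonneg r]
  calc s ^ (-(3 : ℝ) / 2) * exp (-t ^ 2 / (4 * s)) * W n s x y
      ≤ s ^ (-(3 : ℝ) / 2) * exp (-t ^ 2 / (4 * s)) *
          (s ^ (-((n : ℝ) / 2)) * (E * exp (-(r ^ 2 / (16 * s))))) := by
        gcongr
        exact W_le n hs x y
    _ = E * (s ^ (-(((n : ℝ) + 1) / 2 + 1)) *
          (exp (-t ^ 2 / (4 * s)) * exp (-(r ^ 2 / (16 * s))))) := by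
        rw [hpow]
        ring
    _ ≤ _ := by gcongr

theorem poisson_kernel_bound (n : ℕ) (hn : 1 ≤ n) :
    ∃ C > (0 : ℝ), ∃ c > (0 : ℝ), ∀ (x y : EuclideanSpace ℝ (Fin n)) (t : ℝ), 0 < t →
      P n t x y ≤
        C * Real.exp (-c * (‖x - y‖ ^ 2 + ‖x‖ * ‖x - y‖)) *
          (t / (t + ‖x - y‖) ^ (n + 1)) := by
  have ha : 0 < ((n : ℝ) + 1) / 2 := by positivity
  have hG := Gamma_pos_of_pos ha
  refine ⟨Gamma (((n : ℝ) + 1) / 2) * 6 ^ (n + 1), by positivity, 1 / 16, by norm_num,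
    fun x y t ht => ?_⟩
  set r := ‖x - y‖
  set E := exp (-(1 / 16) * (r ^ 2 + ‖x‖ * r))
  have hr0 : 0 ≤ r := norm_nonneg _
  have hb : 0 < ((t + r) / 6) ^ 2 := by positivity
  have hint : ∫ s in Ioi (0 : ℝ), s ^ (-(3 : ℝ) / 2) * exp (-t ^ 2 / (4 * s)) * W n s x y ≤
      E * ((1 / ((t + r) / 6) ^ 2) ^ (((n : ℝ) + 1) / 2) * Gamma (((n : ℝ) + 1) / 2)) := by
    rw [← integral_rpow_mul_exp_neg_div_Ioi ha hb, ← integral_const_mul]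
    refine integral_mono_of_nonneg ?_
      ((integrableOn_rpow_mul_exp_neg_div_Ioi ha hb).const_mul E) ?_
    · filter_upwards [ae_restrict_mem measurableSet_Ioi] with s (hs : 0 < s)
      have := W_nonneg n hs x y
      positivity
    · filter_upwards [ae_restrict_mem measurableSet_Ioi] with s hs
      exact poisson_integrand_le n hs x y t
  have hpow : (1 / ((t + r) / 6) ^ 2) ^ (((n : ℝ) + 1) / 2) = 6 ^ (n + 1) / (t + r) ^ (n + 1) := by
    have hbase : 1 / ((t + r) / 6) ^ 2 = (6 / (t + r)) ^ (2 : ℝ) := by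
      rw [rpow_two]
      field_simp
    rw [hbase, ← rpow_mul (by positivity), ← div_pow, ← rpow_natCast]
    congr 1
    push_cast
    ring
  have hsqrt : t / √(4 * π) ≤ t :=
    div_le_self ht.le (one_le_sqrt.2 (by linarith [pi_gt_three]))
  rw [hpow] at hint
  calc P n t x y ≤ t / √(4 * π) *
        (E * (6 ^ (n + 1) / (t + r) ^ (n + 1) * Gamma (((n : ℝ) + 1) / 2))) :=
        mul_le_mul_of_nonneg_left hint (by positivity)
    _ ≤ t * (E * (6 ^ (n + 1) / (t + r) ^ (n + 1) * Gamma (((n : ℝ) + 1) / 2))) :=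
        mul_le_mul_of_nonneg_right hsqrt (by positivity)
    _ = _ := by ring
end

section
/- Let n ≥ 1 and α > -n. There exists a constant C > 0 such that for all x, y ∈ ℝⁿ with x ≠ y, sup_{s>0} (∫_0^∞ Ω_α(x,y;s,t)² dt/t)^{1/2} ≤ C / |x-y|^n. -/
open Real MeasureTheory Set

/-- Ω_α(x,y;s,t) = t ∂_t P_{t+s}^α(x,y). -/
noncomputable def Om (n : ℕ) (α : ℝ) (x y : EuclideanSpace ℝ (Fin n)) (s t : ℝ) : ℝ :=
  t / Real.sqrt (4 * Real.pi) *
    ∫ u in Set.Ioi (0 : ℝ), u ^ (-(3 : ℝ) / 2) * (1 - (t + s) ^ 2 / (2 * u)) *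
      Real.exp (-(t + s) ^ 2 / (4 * u)) * Real.exp (-α * u) * W n u x y

/-- The substitution `v = u⁻¹` turning an inverse-Gamma integrand into a Gamma integrand. -/
lemma comp_inv_rpow_mul_exp (a A : ℝ) {u : ℝ} (hu : 0 < u) :
    (|(-1 : ℝ)| * u ^ ((-1 : ℝ) - 1)) •
        ((u ^ (-1 : ℝ)) ^ (a - 1) * Real.exp (-(A * u ^ (-1 : ℝ)))) =
      u ^ (-a - 1) * Real.exp (-(A / u)) := by
  rw [← Real.rpow_mul hu.le, smul_eq_mul, abs_neg, abs_one, one_mul, ← mul_assoc,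
    ← Real.rpow_add hu, Real.rpow_neg_one, div_eq_mul_inv]
  ring_nf

lemma integrableOn_rpow_mul_exp_neg_div {a A : ℝ} (ha : 0 < a) (hA : 0 < A) :
    IntegrableOn (fun u : ℝ => u ^ (-a - 1) * Real.exp (-(A / u))) (Ioi 0) := by
  have hg : IntegrableOn (fun v : ℝ => v ^ (a - 1) * Real.exp (-(A * v))) (Ioi 0) := by
    simpa using integrableOn_rpow_mul_exp_neg_mul_rpow (s := a - 1) (by linarith) one_pos hA
  exact ((integrableOn_Ioi_comp_rpow_iff _ (by norm_num : (-1 : ℝ) ≠ 0)).2 hg).congr_fun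
    (fun u hu => comp_inv_rpow_mul_exp a A hu) measurableSet_Ioi

lemma integral_rpow_mul_exp_neg_div {a A : ℝ} (ha : 0 < a) (hA : 0 < A) :
    ∫ u in Ioi (0 : ℝ), u ^ (-a - 1) * Real.exp (-(A / u)) = (1 / A) ^ a * Real.Gamma a := by
  rw [← Real.integral_rpow_mul_exp_neg_mul_Ioi ha hA,
    ← integral_comp_rpow_Ioi (fun v : ℝ => v ^ (a - 1) * Real.exp (-(A * v)))
      (by norm_num : (-1 : ℝ) ≠ 0)]
  exact setIntegral_congr_fun measurableSet_Ioi
    fun u hu => (comp_inv_rpow_mul_exp a A hu).symm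

lemma one_sub_exp_neg_ge {v : ℝ} (hv : 0 < v) : v / (1 + v) ≤ 1 - Real.exp (-v) := by
  have h : Real.exp (-v) ≤ (1 + v)⁻¹ := by
    rw [Real.exp_neg]
    exact inv_anti₀ (by positivity) (by linarith [Real.add_one_le_exp v])
  have : v / (1 + v) = 1 - (1 + v)⁻¹ := by field_simp; ring
  linarith

lemma exp_neg_mul_le {δ u : ℝ} (hδ : 0 < δ) (hu : 0 < u) :
    Real.exp (-(δ * u)) * (1 + 4 * u) ≤ 1 + 4 / δ := by
  rw [Real.exp_neg, inv_mul_le_iff₀ (Real.exp_pos _)]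
  have h1 := Real.add_one_le_exp (δ * u)
  have h2 : 1 + 4 * u ≤ (1 + δ * u) * (1 + 4 / δ) := by
    have : (1 + δ * u) * (1 + 4 / δ) = 1 + 4 * u + (4 / δ + δ * u) := by field_simp; ring
    have : 0 < 4 / δ + δ * u := by positivity
    linarith
  have h3 : 0 < 1 + 4 / δ := by positivity
  nlinarith

/-- Gaussian upper bound for the shifted Mehler kernel. -/
lemma exp_mul_W_le {n : ℕ} (hn : 1 ≤ n) {α : ℝ} (hα : -(n : ℝ) < α) :
    ∃ K > (0 : ℝ), ∀ (x y : EuclideanSpace ℝ (Fin n)) (u : ℝ), 0 < u →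
      Real.exp (-α * u) * W n u x y ≤
        K * u ^ (-((n : ℝ) / 2)) * Real.exp (-(‖x - y‖ ^ 2 / (8 * u))) := by
  have hn0 : (0 : ℝ) < n := by exact_mod_cast hn
  set δ : ℝ := 2 * α / n + 2 with hδdef
  have hδ : 0 < δ := by
    have : δ = 2 * (α + n) / n := by rw [hδdef]; field_simp
    rw [this]
    have : 0 < α + n := by linarith
    positivity
  refine ⟨(1 + 4 / δ) ^ ((n : ℝ) / 2), by positivity, fun x y u hu => ?_⟩
  have hq : Real.exp (-2 * u) < 1 := by rw [Real.exp_lt_one_iff]; linarith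
  have hq4 : 4 * u / (1 + 4 * u) ≤ 1 - Real.exp (-4 * u) := by
    simpa using one_sub_exp_neg_ge (by positivity : 0 < 4 * u)
  have hbase : 0 ≤ Real.exp (-2 * u) / (Real.pi * (1 - Real.exp (-4 * u))) := by
    have : 0 < 1 - Real.exp (-4 * u) := lt_of_lt_of_le (by positivity) hq4
    positivity
  have hα' : Real.exp (-α * u) = Real.exp (-(2 * α / n) * u) ^ ((n : ℝ) / 2) := by
    rw [← Real.exp_mul]
    congr 1
    field_simp
  have hpoly : Real.exp (-(2 * α / n) * u) *
      (Real.exp (-2 * u) / (Real.pi * (1 - Real.exp (-4 * u)))) ≤ (1 + 4 / δ) / u := by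
    have hden : u / (1 + 4 * u) ≤ Real.pi * (1 - Real.exp (-4 * u)) := by
      have h1 : u / (1 + 4 * u) ≤ 4 * u / (1 + 4 * u) := by gcongr; linarith
      have h2 : 0 < 4 * u / (1 + 4 * u) := by positivity
      nlinarith [Real.pi_gt_three]
    calc _ = Real.exp (-(δ * u)) / (Real.pi * (1 - Real.exp (-4 * u))) := by
          rw [← mul_div_assoc, ← Real.exp_add, hδdef]
          ring_nf
      _ ≤ Real.exp (-(δ * u)) / (u / (1 + 4 * u)) := by gcongr
      _ = Real.exp (-(δ * u)) * (1 + 4 * u) / u := by field_simp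
      _ ≤ (1 + 4 / δ) / u := by gcongr; exact exp_neg_mul_le hδ hu
  have hgauss : -(1 / 4) * ((1 + Real.exp (-2 * u)) / (1 - Real.exp (-2 * u)) * ‖x - y‖ ^ 2 +
      (1 - Real.exp (-2 * u)) / (1 + Real.exp (-2 * u)) * ‖x + y‖ ^ 2) ≤
      -(‖x - y‖ ^ 2 / (8 * u)) := by
    have h0 : 0 < 1 - Real.exp (-2 * u) := by linarith
    have h1 : 1 / (2 * u) ≤ (1 + Real.exp (-2 * u)) / (1 - Real.exp (-2 * u)) := by
      have := Real.add_one_le_exp (-2 * u)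
      have := Real.exp_pos (-2 * u)
      exact div_le_div₀ (by positivity) (by linarith) h0 (by linarith)
    have h2 : 0 ≤ (1 - Real.exp (-2 * u)) / (1 + Real.exp (-2 * u)) * ‖x + y‖ ^ 2 := by positivity
    have h3 := mul_le_mul_of_nonneg_right h1 (sq_nonneg ‖x - y‖)
    have h4 : ‖x - y‖ ^ 2 / (8 * u) = 1 / 4 * (1 / (2 * u) * ‖x - y‖ ^ 2) := by
      field_simp; ring
    linarith
  unfold W
  rw [← mul_assoc, hα', ← Real.mul_rpow (Real.exp_nonneg _) hbase, Real.rpow_neg hu.le,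
    ← div_eq_mul_inv, ← Real.div_rpow (by positivity) hu.le]
  gcongr

/-- The polynomial factor of the differentiated subordination kernel is absorbed by half of the
exponential. -/
lemma abs_mul_exp_le {T u : ℝ} (hu : 0 < u) :
    |1 - T ^ 2 / (2 * u)| * Real.exp (-T ^ 2 / (4 * u)) ≤
      4 * Real.exp (-(T ^ 2 / (8 * u))) := by
  set z := T ^ 2 / (8 * u) with hz
  have hz0 : 0 ≤ z := by positivity
  have h1 : T ^ 2 / (2 * u) = 4 * z := by rw [hz]; field_simp; ring
  have h2 : -T ^ 2 / (4 * u) = -z + -z := by rw [hz]; field_simp; ring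
  rw [h1, h2, Real.exp_add, ← mul_assoc]
  gcongr
  rw [Real.exp_neg, mul_inv_le_iff₀ (Real.exp_pos _)]
  have := Real.add_one_le_exp z
  exact abs_le.2 ⟨by linarith, by linarith⟩

/-- Pointwise Poisson-type bound for `Om`. -/
lemma abs_Om_le {n : ℕ} (hn : 1 ≤ n) {α : ℝ} (hα : -(n : ℝ) < α) :
    ∃ M > (0 : ℝ), ∀ x y : EuclideanSpace ℝ (Fin n), x ≠ y → ∀ s t : ℝ, 0 < s → 0 < t →
      |Om n α x y s t| ≤ M * t * (1 / (t ^ 2 + ‖x - y‖ ^ 2)) ^ (((n : ℝ) + 1) / 2) := by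
  obtain ⟨K, hK, hW⟩ := exp_mul_W_le hn hα
  set a : ℝ := ((n : ℝ) + 1) / 2 with ha_def
  have ha : 0 < a := by positivity
  have hΓ := Real.Gamma_pos_of_pos ha
  refine ⟨4 * K * (8 ^ a * Real.Gamma a), by positivity, fun x y hxy s t hs ht => ?_⟩
  have hr : 0 < ‖x - y‖ := norm_pos_iff.2 (sub_ne_zero.2 hxy)
  set A : ℝ := ((t + s) ^ 2 + ‖x - y‖ ^ 2) / 8 with hA_def
  have hA : 0 < A := by positivity
  have hint : |∫ u in Ioi (0 : ℝ), u ^ (-(3 : ℝ) / 2) * (1 - (t + s) ^ 2 / (2 * u)) *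
      Real.exp (-(t + s) ^ 2 / (4 * u)) * Real.exp (-α * u) * W n u x y| ≤
      4 * K * ((1 / A) ^ a * Real.Gamma a) := by
    rw [← integral_rpow_mul_exp_neg_div ha hA, ← integral_const_mul, ← Real.norm_eq_abs]
    refine norm_integral_le_of_norm_le ((integrableOn_rpow_mul_exp_neg_div ha hA).const_mul _) ?_
    filter_upwards [ae_restrict_mem measurableSet_Ioi] with u hu
    have hu : 0 < u := hu
    have hW0 : 0 ≤ W n u x y := by
      have : Real.exp (-4 * u) < 1 := by rw [Real.exp_lt_one_iff]; linarith
      have : 0 < 1 - Real.exp (-4 * u) := by linarith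
      unfold W
      positivity
    have hexp : Real.exp (-((t + s) ^ 2 / (8 * u))) * Real.exp (-(‖x - y‖ ^ 2 / (8 * u))) =
        Real.exp (-(A / u)) := by
      rw [← Real.exp_add, hA_def]
      congr 1
      field_simp
      ring
    have hpow : u ^ (-(3 : ℝ) / 2) * u ^ (-((n : ℝ) / 2)) = u ^ (-a - 1) := by
      rw [← Real.rpow_add hu, ha_def]
      ring_nf
    calc _ = u ^ (-(3 : ℝ) / 2) *
          (|1 - (t + s) ^ 2 / (2 * u)| * Real.exp (-(t + s) ^ 2 / (4 * u))) *
          (Real.exp (-α * u) * W n u x y) := by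
          rw [Real.norm_eq_abs, abs_mul, abs_mul, abs_mul, abs_mul, Real.abs_exp, Real.abs_exp,
            abs_of_nonneg hW0, abs_of_pos (Real.rpow_pos_of_pos hu _)]
          ring
      _ ≤ u ^ (-(3 : ℝ) / 2) * (4 * Real.exp (-((t + s) ^ 2 / (8 * u)))) *
          (K * u ^ (-((n : ℝ) / 2)) * Real.exp (-(‖x - y‖ ^ 2 / (8 * u)))) := by
          gcongr ?_ * ?_ * ?_
          · exact abs_mul_exp_le hu
          · exact hW x y u hu
      _ = 4 * K * (u ^ (-a - 1) * Real.exp (-(A / u))) := by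
          rw [← hexp, ← hpow]
          ring
  have hfactor : t / Real.sqrt (4 * Real.pi) ≤ t :=
    div_le_self ht.le (Real.one_le_sqrt.2 (by linarith [Real.pi_gt_three]))
  have hAle : (1 / A) ^ a ≤ 8 ^ a * (1 / (t ^ 2 + ‖x - y‖ ^ 2)) ^ a := by
    rw [← Real.mul_rpow (by norm_num) (by positivity)]
    have : 1 / A = 8 * (1 / ((t + s) ^ 2 + ‖x - y‖ ^ 2)) := by rw [hA_def]; field_simp
    rw [this]
    gcongr
    linarith
  unfold Om
  rw [abs_mul, abs_of_nonneg (by positivity : 0 ≤ t / Real.sqrt (4 * Real.pi))]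
  calc _ ≤ t * (4 * K * ((1 / A) ^ a * Real.Gamma a)) := by gcongr
    _ ≤ t * (4 * K * (8 ^ a * (1 / (t ^ 2 + ‖x - y‖ ^ 2)) ^ a * Real.Gamma a)) := by gcongr
    _ = _ := by ring

section RadialIntegral

variable {n : ℕ} {r : ℝ}

lemma hasDerivAt_inv_sq_add_sq_pow (hn : 1 ≤ n) (hr : 0 < r) (t : ℝ) :
    HasDerivAt (fun t : ℝ => -((2 * n : ℝ)⁻¹ * ((t ^ 2 + r ^ 2) ^ n)⁻¹))
      (t * ((t ^ 2 + r ^ 2) ^ (n + 1))⁻¹) t := by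
  obtain ⟨m, rfl⟩ : ∃ m, n = m + 1 := ⟨n - 1, by omega⟩
  have hpos : 0 < t ^ 2 + r ^ 2 := by positivity
  have h := (((((hasDerivAt_id t).pow 2).add_const (r ^ 2)).pow (m + 1)).inv
    (pow_pos hpos _).ne').const_mul (2 * ((m + 1 : ℕ) : ℝ))⁻¹ |>.neg
  refine h.congr_deriv ?_
  simp only [id, Nat.add_sub_cancel, Pi.pow_apply]
  have : ((m + 1 : ℕ) : ℝ) ≠ 0 := by positivity
  field_simp
  push_cast
  ring

lemma tendsto_inv_sq_add_sq_pow (hn : 1 ≤ n) :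
    Filter.Tendsto (fun t : ℝ => -((2 * n : ℝ)⁻¹ * ((t ^ 2 + r ^ 2) ^ n)⁻¹))
      Filter.atTop (nhds 0) := by
  have h : Filter.Tendsto (fun t : ℝ => (t ^ 2 + r ^ 2) ^ n) Filter.atTop Filter.atTop :=
    (Filter.tendsto_pow_atTop (by omega)).comp
      (Filter.tendsto_atTop_add_const_right _ _ (Filter.tendsto_pow_atTop two_ne_zero))
  simpa using (h.inv_tendsto_atTop.const_mul (2 * n : ℝ)⁻¹).neg

lemma integrableOn_mul_inv_sq_add_sq_pow (hn : 1 ≤ n) (hr : 0 < r) :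
    IntegrableOn (fun t : ℝ => t * ((t ^ 2 + r ^ 2) ^ (n + 1))⁻¹) (Ioi 0) :=
  integrableOn_Ioi_deriv_of_nonneg' (fun t _ => hasDerivAt_inv_sq_add_sq_pow hn hr t)
    (fun t ht => mul_nonneg (le_of_lt ht) (by positivity)) (tendsto_inv_sq_add_sq_pow hn)

lemma integral_mul_inv_sq_add_sq_pow (hn : 1 ≤ n) (hr : 0 < r) :
    ∫ t in Ioi (0 : ℝ), t * ((t ^ 2 + r ^ 2) ^ (n + 1))⁻¹ = (2 * n : ℝ)⁻¹ * ((r ^ 2) ^ n)⁻¹ := by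
  rw [integral_Ioi_of_hasDerivAt_of_nonneg' (fun t _ => hasDerivAt_inv_sq_add_sq_pow hn hr t)
    (fun t ht => mul_nonneg (le_of_lt ht) (by positivity)) (tendsto_inv_sq_add_sq_pow hn)]
  simp

end RadialIntegral

theorem Om_H_norm_bound (n : ℕ) (hn : 1 ≤ n) (α : ℝ) (hα : -(n : ℝ) < α) :
    ∃ C > (0 : ℝ), ∀ x y : EuclideanSpace ℝ (Fin n), x ≠ y →
      (⨆ (s : ℝ) (_ : (0 : ℝ) < s),
        Real.sqrt (∫ t in Set.Ioi (0 : ℝ), Om n α x y s t ^ 2 / t)) ≤ C / ‖x - y‖ ^ n := by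
  obtain ⟨M, hM, hOm⟩ := abs_Om_le hn hα
  refine ⟨M, hM, fun x y hxy => ?_⟩
  have hr : 0 < ‖x - y‖ := norm_pos_iff.2 (sub_ne_zero.2 hxy)
  have hn1 : (1 : ℝ) ≤ n := by exact_mod_cast hn
  refine Real.iSup_le (fun s => Real.iSup_le (fun hs => ?_) (by positivity)) (by positivity)
  refine Real.sqrt_le_iff.2 ⟨by positivity, ?_⟩
  calc ∫ t in Ioi (0 : ℝ), Om n α x y s t ^ 2 / t
      ≤ ∫ t in Ioi (0 : ℝ), M ^ 2 * (t * ((t ^ 2 + ‖x - y‖ ^ 2) ^ (n + 1))⁻¹) := by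
        refine integral_mono_of_nonneg ?_
          ((integrableOn_mul_inv_sq_add_sq_pow hn hr).const_mul _) ?_
        · filter_upwards [ae_restrict_mem measurableSet_Ioi] with t ht
          exact div_nonneg (sq_nonneg _) (le_of_lt ht)
        · filter_upwards [ae_restrict_mem measurableSet_Ioi] with t ht
          have ht : 0 < t := ht
          rw [div_le_iff₀ ht, ← sq_abs]
          have hsq : ((1 / (t ^ 2 + ‖x - y‖ ^ 2)) ^ (((n : ℝ) + 1) / 2)) ^ 2 =
              ((t ^ 2 + ‖x - y‖ ^ 2) ^ (n + 1))⁻¹ := by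
            rw [← Real.rpow_mul_natCast (by positivity)]
            have : ((n : ℝ) + 1) / 2 * (2 : ℕ) = ((n + 1 : ℕ) : ℝ) := by push_cast; ring
            rw [this, Real.rpow_natCast, one_div, inv_pow]
          calc |Om n α x y s t| ^ 2
              ≤ (M * t * (1 / (t ^ 2 + ‖x - y‖ ^ 2)) ^ (((n : ℝ) + 1) / 2)) ^ 2 := by
                gcongr
                exact hOm x y hxy s t hs ht
            _ = M ^ 2 * (t * ((t ^ 2 + ‖x - y‖ ^ 2) ^ (n + 1))⁻¹) * t := by
                rw [mul_pow, hsq]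
                ring
    _ = (2 * n : ℝ)⁻¹ * (M / ‖x - y‖ ^ n) ^ 2 := by
        rw [integral_const_mul, integral_mul_inv_sq_add_sq_pow hn hr, div_pow, ← pow_mul,
          ← pow_mul, mul_comm 2 n]
        ring
    _ ≤ (M / ‖x - y‖ ^ n) ^ 2 :=
        mul_le_of_le_one_left (sq_nonneg _) (inv_le_one_of_one_le₀ (by linarith))
end
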